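/- Let p be a prime and let α, m be nonnegative integers with m ≥ p and p^α < m ≤ p^{α+1}. Then p^α·(p-1) is a period of the sequence (S(l,m))_{l ≥ m} modulo p; that is, for all integers l', l with l' ≥ l ≥ m and l' ≡ l (mod p^α(p-1)), one has S(l',m) ≡ S(l,m) (mod p). -/

import Mathlib

/-- Stirling numbers of the second kind: `stirling2 l m` is the number of ways to
partition a set of cardinality `l` into `m` nonempty subsets. -/
def stirling2 : ℕ → ℕ → ℕ
  | 0, 0 => 1
  | 0, _ + 1 => 0
  | _ + 1, 0 => 0
  | n + 1, k + 1 => (k + 1) * stirling2 n (k + 1) + stirling2 n k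

open Polynomial in
/-- The product `∏ k ∈ {1, …, m}, (1 - k X)`, the denominator of the generating function of
the Stirling numbers of the second kind. -/
noncomputable def stirlingDenom (R : Type*) [CommRing R] (m : ℕ) : R[X] :=
  ∏ k ∈ Finset.range m, (1 - C ((k + 1 : ℕ) : R) * X)

theorem stirling2_of_lt : ∀ {l m : ℕ}, l < m → stirling2 l m = 0
  | 0, _ + 1, _ => by simp [stirling2]
  | l + 1, m + 1, h => by
    rw [stirling2, stirling2_of_lt (by omega : l < m + 1), stirling2_of_lt (by omega : l < m)]
    simp

theorem stirling2_self : ∀ m : ℕ, stirling2 m m = 1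
  | 0 => by simp [stirling2]
  | m + 1 => by rw [stirling2, stirling2_of_lt m.lt_succ_self, stirling2_self m, mul_zero, zero_add]

open PowerSeries in
theorem mk_stirling2_mul_stirlingDenom (R : Type*) [CommRing R] (m : ℕ) :
    (PowerSeries.mk fun n => (stirling2 (n + m) m : R)) * (stirlingDenom R m : R⟦X⟧) = 1 := by
  induction m with
  | zero =>
    ext n
    cases n <;> simp [stirlingDenom, stirling2, PowerSeries.coeff_one]
  | succ m ih =>
    have step : (PowerSeries.mk fun n => (stirling2 (n + (m + 1)) (m + 1) : R)) *
        (1 - PowerSeries.C ((m + 1 : ℕ) : R) * PowerSeries.X) =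
        PowerSeries.mk fun n => (stirling2 (n + m) m : R) := by
      rw [mul_sub, mul_one, mul_left_comm]
      ext n
      cases n with
      | zero => simp [stirling2_self]
      | succ n =>
        rw [map_sub, PowerSeries.coeff_C_mul, PowerSeries.coeff_succ_mul_X]
        simp only [PowerSeries.coeff_mk]
        rw [show n + 1 + (m + 1) = n + (m + 1) + 1 by ring, stirling2,
          show n + 1 + m = n + (m + 1) by ring]
        push_cast
        ring
    rw [← ih, ← step, stirlingDenom, Finset.prod_range_succ, ← stirlingDenom]
    simp only [Polynomial.coe_mul, Polynomial.coe_sub, Polynomial.coe_one, Polynomial.coe_C,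
      Polynomial.coe_X]
    ring

open Polynomial in
theorem stirlingDenom_mul (p : ℕ) (N : ℕ) :
    stirlingDenom (ZMod p) (p * N) = stirlingDenom (ZMod p) p ^ N := by
  induction N with
  | zero => simp [stirlingDenom]
  | succ N ih =>
    rw [pow_succ, ← ih, mul_add, mul_one]
    simp [stirlingDenom, Finset.prod_range_add]

open Polynomial in
theorem stirlingDenom_prime_dvd (p : ℕ) [Fact p.Prime] :
    stirlingDenom (ZMod p) p ∣ 1 - X ^ (p - 1) := by
  refine Finset.prod_dvd_of_coprime ?_ ?_
  · intro i hi j hj hij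
    have hi' : i < p := by simpa using hi
    have hj' : j < p := by simpa using hj
    have hne : ((j + 1 : ℕ) : ZMod p) - ((i + 1 : ℕ) : ZMod p) ≠ 0 := by
      intro h
      have h' : (j : ZMod p) = i := by
        push_cast at h
        linear_combination h
      rw [ZMod.natCast_eq_natCast_iff', Nat.mod_eq_of_lt hi', Nat.mod_eq_of_lt hj'] at h'
      exact hij h'.symm
    set a := ((i + 1 : ℕ) : ZMod p)
    set b := ((j + 1 : ℕ) : ZMod p)
    refine ⟨C ((b - a)⁻¹) * C b, -(C ((b - a)⁻¹) * C a), ?_⟩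
    have h1 : C ((b - a)⁻¹) * (C b - C a) = (1 : (ZMod p)[X]) := by
      rw [← C_sub, ← C_mul, inv_mul_cancel₀ hne, C_1]
    linear_combination h1
  · intro i _
    by_cases ha : ((i + 1 : ℕ) : ZMod p) = 0
    · simp [ha]
    · have h := sub_dvd_pow_sub_pow (1 : (ZMod p)[X]) (C ((i + 1 : ℕ) : ZMod p) * X) (p - 1)
      rwa [one_pow, mul_pow, ← C_pow, ZMod.pow_card_sub_one_eq_one ha, C_1, one_mul] at h

open Polynomial in
theorem stirlingDenom_dvd (p : ℕ) [Fact p.Prime] {α m : ℕ} (hm : m ≤ p ^ (α + 1)) :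
    stirlingDenom (ZMod p) m ∣ 1 - X ^ (p ^ α * (p - 1)) := by
  have hle : stirlingDenom (ZMod p) m ∣ stirlingDenom (ZMod p) (p * p ^ α) :=
    Finset.prod_dvd_prod_of_subset _ _ _
      (Finset.range_subset_range.2 (by rwa [pow_succ'] at hm))
  have hpow := pow_dvd_pow_of_dvd (stirlingDenom_prime_dvd p) (p ^ α)
  rw [← stirlingDenom_mul, sub_pow_char_pow, one_pow, ← pow_mul, mul_comm (p - 1)] at hpow
  exact hle.trans hpow

open Polynomial in
theorem natDegree_stirlingDenom_pos (R : Type*) [CommRing R] [IsDomain R] {m : ℕ} (hm : 0 < m)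
    (h0 : stirlingDenom R m ≠ 0) : 0 < (stirlingDenom R m).natDegree := by
  have hdvd : (1 - X : R[X]) ∣ stirlingDenom R m := by
    have h := Finset.dvd_prod_of_mem (fun k : ℕ => (1 - C ((k + 1 : ℕ) : R) * X))
      (Finset.mem_range.2 hm)
    rwa [zero_add, Nat.cast_one, C_1, one_mul] at h
  have hdeg : (1 - X : R[X]).natDegree = 1 := by
    rw [← neg_sub, natDegree_neg, ← C_1, natDegree_X_sub_C]
  have := natDegree_le_of_dvd hdvd h0
  omega

open Polynomial in
theorem stirling2_add_period (p : ℕ) [Fact p.Prime] {α m : ℕ} (hm0 : 0 < m)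
    (hm : m ≤ p ^ (α + 1)) (n : ℕ) :
    (stirling2 (n + p ^ α * (p - 1) + m) m : ZMod p) = stirling2 (n + m) m := by
  have hp : p.Prime := Fact.out
  obtain ⟨r, hr⟩ := stirlingDenom_dvd p hm
  set T := p ^ α * (p - 1)
  have hTpos : 0 < T := Nat.mul_pos (pow_pos hp.pos _) (Nat.sub_pos_of_lt hp.one_lt)
  have hdegT : (1 - X ^ T : (ZMod p)[X]).natDegree = T := by
    rw [← neg_sub, natDegree_neg, ← C_1, natDegree_X_pow_sub_C]
  have hne : (1 - X ^ T : (ZMod p)[X]) ≠ 0 := by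
    intro h
    rw [h, natDegree_zero] at hdegT
    omega
  have hQ : stirlingDenom (ZMod p) m ≠ 0 := by
    rintro h
    exact hne (by rw [hr, h, zero_mul])
  have hr0 : r ≠ 0 := by
    rintro h
    exact hne (by rw [hr, h, mul_zero])
  have hrdeg : r.natDegree < T := by
    have := natDegree_stirlingDenom_pos (ZMod p) hm0 hQ
    rw [hr, natDegree_mul hQ hr0] at hdegT
    omega
  have key : (PowerSeries.mk fun n => (stirling2 (n + m) m : ZMod p)) *
      (1 - PowerSeries.X ^ T) = (r : PowerSeries (ZMod p)) := by
    have h := congrArg (fun f : (ZMod p)[X] => (f : PowerSeries (ZMod p))) hr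
    simp only [Polynomial.coe_mul, Polynomial.coe_sub, Polynomial.coe_one, Polynomial.coe_pow,
      Polynomial.coe_X] at h
    rw [h, ← mul_assoc, mk_stirling2_mul_stirlingDenom, one_mul]
  have hc := congrArg (PowerSeries.coeff (n + T)) key
  rw [mul_sub, mul_one, map_sub, PowerSeries.coeff_mul_X_pow, Polynomial.coeff_coe,
    coeff_eq_zero_of_natDegree_lt (by omega)] at hc
  simpa [sub_eq_zero] using hc

/-- Corollary 1.2 (Carlitz): let `p` be a prime and `α, m ∈ ℕ` with `m ≥ p` and
`p^α < m ≤ p^{α+1}`.  Then `p^α(p-1)` is a period of the sequence `S(l,m)` (`l ≥ m`)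
modulo `p`: if `l' ≥ l ≥ m` and `l' ≡ l (mod p^α(p-1))` then `S(l',m) ≡ S(l,m) (mod p)`. -/
theorem stirling_period_mod_p
    (p : ℕ) (hp : p.Prime) (α m : ℕ) (hmp : p ≤ m)
    (h1 : p ^ α < m) (h2 : m ≤ p ^ (α + 1))
    (l l' : ℕ) (hml : m ≤ l) (hll' : l ≤ l')
    (hcong : l' ≡ l [MOD p ^ α * (p - 1)]) :
    stirling2 l' m ≡ stirling2 l m [MOD p] := by
  have := Fact.mk hp
  have hm0 : 0 < m := hp.pos.trans_le hmp
  rw [← ZMod.natCast_eq_natCast_iff]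
  obtain ⟨k, hk⟩ := (Nat.modEq_iff_dvd' hll').1 hcong.symm
  obtain ⟨n, rfl⟩ := Nat.exists_eq_add_of_le' hml
  have hl' : l' = n + p ^ α * (p - 1) * k + m := by omega
  have hper : Function.Periodic (fun n => (stirling2 (n + m) m : ZMod p)) (p ^ α * (p - 1)) :=
    stirling2_add_period p hm0 h2
  have := hper.nat_mul k n
  rw [hl', mul_comm _ k]
  exact this
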